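/- arXiv:2502.08462 — 2 statements merged into one kernel-verified Lean document; each statement's English description precedes it below -/
import Mathlib

section
/- Let k ≥ 2 be an integer and let G be a finite graph with non-empty (k+1)-core C. Let G' be obtained from G by adding one new edge e, and let C' be the (k+1)-core of G' (so V(C) ⊆ V(C')). Set V₁ = |V(C')| − |V(C)|, let E₁ be the number of edges of G' with both endpoints in V(C') \ V(C), and let Δ = rk_k(E(C')) − rk_k(E(C)). If k·V₁ − Δ > 0, then E₁ − V₁ ≥ k·V₁ − Δ. -/
open MeasureTheory Filter

noncomputable section

/-- `∑_{i ≥ k} x^i / i!`. -/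
noncomputable def sumFrom (k : ℕ) (x : ℝ) : ℝ :=
  ∑' i : ℕ, if k ≤ i then x ^ i / (Nat.factorial i) else 0

/-- `π_k(x) = Pr[Pois(x) ≥ k] = ∑_{i ≥ k} x^i e^{-x} / i!`. -/
noncomputable def ptail (k : ℕ) (x : ℝ) : ℝ :=
  ∑' i : ℕ, if k ≤ i then x ^ i * Real.exp (-x) / (Nat.factorial i) else 0

/-- `c` is the positive root of `c · (∑_{i≥k−1}(2c)^i/i!)/(∑_{i≥k}(2c)^i/i!) = k`,
i.e. the constant `c'_k`. -/
def IsCkPrime (k : ℕ) (c : ℝ) : Prop :=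
  0 < c ∧ c * sumFrom (k - 1) (2 * c) = k * sumFrom k (2 * c)

/-- `lam` is the largest root `λ` of `c = λ / π_{j-1}(λ)`, i.e. of `λ = c · π_{j-1}(λ)`. -/
def IsLambda (j : ℕ) (c lam : ℝ) : Prop :=
  lam = c * ptail (j - 1) lam ∧ ∀ mu : ℝ, mu = c * ptail (j - 1) mu → mu ≤ lam

/-- `b` is the largest root `β` of the equation `β = Pr[Pois(βc) ≥ k]`. -/
def IsBetaVal (k : ℕ) (c b : ℝ) : Prop :=
  b = ptail k (b * c) ∧ ∀ b' : ℝ, b' = ptail k (b' * c) → b' ≤ b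

/-- A set of edges is a spanning tree (on the whole vertex type `V`) if the graph it
spans is connected and acyclic. -/
def IsSpanningTreeSet {V : Type*} (T : Set (Sym2 V)) : Prop :=
  (SimpleGraph.fromEdgeSet T).Connected ∧ (SimpleGraph.fromEdgeSet T).IsAcyclic

/-- A graph is `k`-deeply connected if it contains `k` pairwise edge-disjoint
spanning trees. -/
def DeeplyConnected {V : Type*} (k : ℕ) (G : SimpleGraph V) : Prop :=
  ∃ T : Fin k → Set (Sym2 V),
    (∀ i, T i ⊆ G.edgeSet) ∧ (∀ i, IsSpanningTreeSet (T i)) ∧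
    Pairwise fun i j => Disjoint (T i) (T j)

/-- A `k`-deeply connected component: a vertex set inducing a `k`-deeply connected
subgraph, maximal by inclusion with this property. -/
def DeepComponent {V : Type*} (k : ℕ) (G : SimpleGraph V) (C : Set V) : Prop :=
  DeeplyConnected k (G.induce C) ∧
    ∀ C' : Set V, C ⊆ C' → DeeplyConnected k (G.induce C') → C' = C

/-- The `κ`-core of a graph: the largest vertex set each of whose vertices has at
least `κ` neighbours inside the set. -/
def coreSet {V : Type*} (κ : ℕ) (G : SimpleGraph V) : Set V :=
  ⋃₀ {C : Set V | ∀ v ∈ C, κ ≤ (C ∩ G.neighborSet v).ncard}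

/-- `E` can be written as a disjoint union of `k` forests. -/
def PartitionsIntoForests {V : Type*} (k : ℕ) (E : Finset (Sym2 V)) : Prop :=
  ∃ F : Fin k → Finset (Sym2 V),
    (∀ i, F i ⊆ E) ∧ (∀ e ∈ E, ∃ i, e ∈ F i) ∧
    (Pairwise fun i j => Disjoint (F i) (F j)) ∧
    ∀ i, (SimpleGraph.fromEdgeSet (↑(F i) : Set (Sym2 V))).IsAcyclic

/-- The rank of an edge set in the union matroid `M^k` of `k` copies of the graphic
matroid: the largest cardinality of a subset that splits into `k` forests. -/
noncomputable def rkk {V : Type*} (k : ℕ) (E : Set (Sym2 V)) : ℕ :=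
  sSup {m : ℕ | ∃ F : Finset (Sym2 V), ↑F ⊆ E ∧ PartitionsIntoForests k F ∧ F.card = m}

/-- The edges of `S` with both endpoints in `U`. -/
def edgesIn {V : Type*} (S : Set (Sym2 V)) (U : Set V) : Set (Sym2 V) :=
  {e | e ∈ S ∧ ∀ v ∈ e, v ∈ U}

instance measFinset {n : ℕ} : MeasurableSpace (Finset (Sym2 (Fin n))) := ⊤

/-- The `m`-element sets of non-loop edges of `K_n`. -/
def graphEdgeSets (n m : ℕ) : Finset (Finset (Sym2 (Fin n))) :=
  Finset.univ.filter fun S => S.card = m ∧ ∀ e ∈ S, ¬ e.IsDiag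

/-- The uniform random graph `G(n,m)`, as a measure on edge sets. -/
noncomputable def gnm (n m : ℕ) : Measure (Finset (Sym2 (Fin n))) :=
  ((graphEdgeSets n m).card : ENNReal)⁻¹ • ∑ S ∈ graphEdgeSets n m, Measure.dirac S

/-- The binomial random graph `G(n,p)`, as a measure on edge sets. -/
noncomputable def gnp (n : ℕ) (p : ℝ) : Measure (Finset (Sym2 (Fin n))) :=
  ∑ S ∈ (Finset.univ.filter fun S : Finset (Sym2 (Fin n)) => ∀ e ∈ S, ¬ e.IsDiag),
    ENNReal.ofReal (p ^ S.card * (1 - p) ^ (n.choose 2 - S.card)) • Measure.dirac S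

/-- The graph spanned by a finite set of edges. -/
def graphOf {n : ℕ} (S : Finset (Sym2 (Fin n))) : SimpleGraph (Fin n) :=
  SimpleGraph.fromEdgeSet (↑S : Set (Sym2 (Fin n)))

instance measProc {n : ℕ} : MeasurableSpace (Fin (n.choose 2) → Sym2 (Fin n)) := ⊤

/-- Enumerations of the edges of `K_n` in some order: the sample space of the
random graph process. -/
def procSet (n : ℕ) : Finset (Fin (n.choose 2) → Sym2 (Fin n)) :=
  Finset.univ.filter fun f => Function.Injective f ∧ ∀ i, ¬ (f i).IsDiag

/-- The random graph process: a uniformly random enumeration of the edges of `K_n`. -/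
noncomputable def procMeasure (n : ℕ) : Measure (Fin (n.choose 2) → Sym2 (Fin n)) :=
  ((procSet n).card : ENNReal)⁻¹ • ∑ f ∈ procSet n, Measure.dirac f

/-- The first `m` edges of the process `f`, i.e. the edge set of `G_m`. -/
def edgesUpTo (n : ℕ) (f : Fin (n.choose 2) → Sym2 (Fin n)) (m : ℕ) : Set (Sym2 (Fin n)) :=
  {e | ∃ i : Fin (n.choose 2), (i : ℕ) < m ∧ f i = e}

/-- The non-loop edges of `K_n`, i.e. the index set of i.i.d. edge weights. -/
abbrev EdgeType (n : ℕ) : Type := {e : Sym2 (Fin n) // ¬ e.IsDiag}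

/-- The minimum total weight of a union of `k` pairwise edge-disjoint spanning
trees of the complete graph `K_n` with edge weights `w`. -/
noncomputable def minTreesWeight (k n : ℕ) (w : EdgeType n → ℝ) : ℝ :=
  sInf {W : ℝ | ∃ T : Fin k → Finset (EdgeType n),
    (∀ i, IsSpanningTreeSet (Subtype.val '' (↑(T i) : Set (EdgeType n)))) ∧
    (Pairwise fun i j => Disjoint (T i) (T j)) ∧
    W = ∑ i : Fin k, ∑ e ∈ T i, w e}

/-- The sum over all non-trivial `k`-deeply connected components `C` of `G_m`
of `(|C|/n)²`, in the random graph process `f`. -/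
noncomputable def sqSum (k n : ℕ) (f : Fin (n.choose 2) → Sym2 (Fin n)) (m : ℕ) : ℝ :=
  ∑ᶠ C ∈ {C : Set (Fin n) |
      DeepComponent k (SimpleGraph.fromEdgeSet (edgesUpTo n f m)) C ∧ 2 ≤ C.ncard},
    ((C.ncard : ℝ) / n) ^ 2

/-- The rank increment `𝕀_i = rk_k(G_i) − rk_k(G_{i−1})` in the random graph process. -/
noncomputable def rkInc (k n : ℕ) (i : ℕ) (f : Fin (n.choose 2) → Sym2 (Fin n)) : ℝ :=
  (rkk k (edgesUpTo n f i) : ℝ) - (rkk k (edgesUpTo n f (i - 1)) : ℝ)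

/-- `𝒫'_i`: the conditional expectation of `𝕀_i` given the first `i−1` edges. -/
noncomputable def condP (k n : ℕ) (i : ℕ) : (Fin (n.choose 2) → Sym2 (Fin n)) → ℝ :=
  MeasureTheory.condExp
    (MeasurableSpace.comap (fun f => (List.ofFn f).take (i - 1)) (⊤ : MeasurableSpace (List (Sym2 (Fin n)))))
    (procMeasure n) (rkInc k n i)

/-- The rank function of a matroid: the largest size of an independent subset. -/
noncomputable def matRank {α : Type*} (M : Matroid α) (X : Set α) : ℕ :=
  sSup {m : ℕ | ∃ I ⊆ X, M.Indep I ∧ I.ncard = m}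

end

/-- The edges of `S` inside `W` that contain `v`. -/
def starAt {V : Type*} (S : Set (Sym2 V)) (W : Set V) (v : V) : Set (Sym2 V) :=
  {t | t ∈ edgesIn S W ∧ v ∈ t}

/-- Adding a pendant edge to a forest gives a forest. -/
lemma acyclic_insert {V : Type*} (F : Set (Sym2 V)) (v : V) (t : Sym2 V)
    (hv : ∀ s ∈ F, v ∉ s) (hvt : v ∈ t) (ht : ¬ t.IsDiag)
    (hF : (SimpleGraph.fromEdgeSet F).IsAcyclic) :
    (SimpleGraph.fromEdgeSet (insert t F)).IsAcyclic := by
  obtain ⟨w, rfl⟩ := hvt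
  have hvw : v ≠ w := by simpa using ht
  have h1 : SimpleGraph.fromEdgeSet (insert s(v, w) F)
      = SimpleGraph.fromEdgeSet F ⊔ SimpleGraph.edge v w := by
    rw [SimpleGraph.edge, ← SimpleGraph.fromEdgeSet_union, Set.union_comm]; rfl
  rw [h1]
  apply SimpleGraph.IsAcyclic.sup_edge_of_not_reachable _ hF
  rintro ⟨p⟩
  cases p with
  | nil => exact hvw rfl
  | cons h q =>
    rw [SimpleGraph.fromEdgeSet_adj] at h
    exact hv _ h.1 (Sym2.mem_mk_left _ _)

/-- Choice of distinct colours avoiding one colour at one edge. -/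
lemma exists_colour {α : Type*} [Finite α] (k : ℕ) (hk : 2 ≤ k) (i0 : Fin k) (T : Set α)
    (P : α → Prop) (hT : T.ncard ≤ k)
    (h : T.ncard ≤ k - 1 ∨ ∃ t0, ∀ t ∈ T, P t → t = t0) :
    ∃ c : α → Fin k, Set.InjOn c T ∧ ∀ t ∈ T, P t → c t ≠ i0 := by
  have : Nonempty (Fin k) := ⟨i0⟩
  rcases h with h | ⟨t0, h0⟩
  · have hc : ({i0}ᶜ : Set (Fin k)).ncard = k - 1 := by
      rw [Set.ncard_compl]; simp
    have hle : T.encard ≤ ({i0}ᶜ : Set (Fin k)).encard := by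
      rw [← (Set.toFinite T).cast_ncard_eq, ← (Set.toFinite ({i0}ᶜ : Set (Fin k))).cast_ncard_eq, hc]
      exact_mod_cast h
    obtain ⟨c, h1, h2⟩ := (Set.toFinite T).exists_injOn_of_encard_le hle
    exact ⟨c, h2, fun t ht _ => h1 ht⟩
  · have hle : T.encard ≤ (Set.univ : Set (Fin k)).encard := by
      rw [← (Set.toFinite T).cast_ncard_eq, ← (Set.toFinite (Set.univ : Set (Fin k))).cast_ncard_eq,
        Set.ncard_univ]
      rw [Nat.card_fin]
      exact_mod_cast hT
    obtain ⟨c, h1, h2⟩ := (Set.toFinite T).exists_injOn_of_encard_le hle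
    by_cases hc : c t0 = i0
    · have : Nontrivial (Fin k) := Fin.nontrivial_iff_two_le.mpr hk
      obtain ⟨i1, hi1⟩ := exists_ne i0
      refine ⟨fun t => Equiv.swap i0 i1 (c t), fun a ha b hb hab => h2 ha hb (by simpa using hab), ?_⟩
      intro t ht hP
      rw [h0 t ht hP]
      simpa [hc] using hi1
    · exact ⟨c, h2, fun t ht hP => by rw [h0 t ht hP]; exact hc⟩

/-- Extending a decomposition into forests along a peeling. -/
lemma extend_forests {V : Type*} [Finite V] (k : ℕ) (hk : 2 ≤ k) (i0 : Fin k)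
    (S : Set (Sym2 V)) (hS : ∀ e ∈ S, ¬ e.IsDiag) (C C' : Set V) (y : V)
    (F0 : Fin k → Set (Sym2 V)) (hsub : ∀ i, F0 i ⊆ edgesIn S C)
    (hdis : Pairwise fun i j => Disjoint (F0 i) (F0 j))
    (hac : ∀ i, (SimpleGraph.fromEdgeSet (F0 i)).IsAcyclic)
    (Q : ∀ W, C ⊂ W → W ⊆ C' → ∃ v ∈ W, v ∉ C ∧ (starAt S W v).ncard ≤ k ∧
      (v = y → (starAt S W v).ncard ≤ k - 1)) :
    ∀ n : ℕ, ∀ W : Set V, C ⊆ W → W ⊆ C' → W.ncard = n →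
      ∃ F : Fin k → Set (Sym2 V),
        (⋃ i, F i) = (⋃ i, F0 i) ∪ (edgesIn S W \ edgesIn S C) ∧
        (Pairwise fun i j => Disjoint (F i) (F j)) ∧
        (∀ i, (SimpleGraph.fromEdgeSet (F i)).IsAcyclic) ∧
        (y ∉ C → ∀ t ∈ F i0, y ∉ t) := by
  intro n
  induction n with
  | zero =>
    intro W hCW hW hn
    have hW0 : W = ∅ := (Set.ncard_eq_zero (Set.toFinite W)).1 hn
    have hC0 : C = W := by rw [hW0] at hCW ⊢; exact Set.subset_empty_iff.1 hCW
    subst hC0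
    refine ⟨F0, by simp, hdis, hac, fun hy t ht hyt => hy ((hsub _ ht).2 y hyt)⟩
  | succ n ih =>
    intro W hCW hW hn
    rcases eq_or_ne C W with rfl | hne
    · exact ⟨F0, by simp, hdis, hac, fun hy t ht hyt => hy ((hsub _ ht).2 y hyt)⟩
    obtain ⟨v, hvW, hvC, hvk, hvy⟩ := Q W (lt_of_le_of_ne hCW hne) hW
    obtain ⟨F, hFU, hFd, hFa, hFy⟩ := ih (W \ {v})
      (fun x hx => ⟨hCW hx, fun h => hvC (h ▸ hx)⟩) (fun x hx => hW hx.1)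
      (by rw [Set.ncard_sdiff_singleton_of_mem hvW]; omega)
    have hFv : ∀ i, ∀ t ∈ F i, v ∉ t := by
      intro i t ht hvt
      have : t ∈ ⋃ i, F i := Set.mem_iUnion.2 ⟨i, ht⟩
      rw [hFU] at this
      rcases this with h | h
      · obtain ⟨j, hj⟩ := Set.mem_iUnion.1 h
        exact hvC ((hsub j hj).2 v hvt)
      · exact (h.1.2 v hvt).2 rfl
    obtain ⟨c, hc1, hc2⟩ := exists_colour k hk i0 (starAt S W v) (fun t => y ∈ t) hvk (by
      by_cases h : v = y
      · exact Or.inl (hvy h)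
      · right
        refine ⟨s(v, y), fun t ht hy => ?_⟩
        exact (Sym2.mem_and_mem_iff h).1 ⟨ht.2, hy⟩)
    refine ⟨fun i => F i ∪ {t | t ∈ starAt S W v ∧ c t = i}, ?_, ?_, ?_, ?_⟩
    · rw [Set.iUnion_union_distrib, hFU, Set.union_assoc]
      congr 1
      ext t
      simp only [Set.mem_union, Set.mem_iUnion, Set.mem_ofPred_eq, Set.mem_sdiff, edgesIn, starAt,
        Set.mem_singleton_iff]
      constructor
      · rintro (⟨⟨h1, h2⟩, h3⟩ | ⟨i, ⟨⟨h1, h2⟩, h3⟩, -⟩)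
        · exact ⟨⟨h1, fun x hx => (h2 x hx).1⟩, h3⟩
        · exact ⟨⟨h1, h2⟩, fun h => hvC (h.2 v h3)⟩
      · rintro ⟨⟨h1, h2⟩, h3⟩
        by_cases hvt : v ∈ t
        · exact Or.inr ⟨c t, ⟨⟨h1, h2⟩, hvt⟩, rfl⟩
        · exact Or.inl ⟨⟨h1, fun x hx => ⟨h2 x hx, fun h => hvt (h ▸ hx)⟩⟩, h3⟩
    · intro i j hij
      rw [Set.disjoint_left]
      rintro t (h | h) (h' | h')
      · exact Set.disjoint_left.1 (hFd hij) h h'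
      · exact hFv i t h h'.1.2
      · exact hFv j t h' h.1.2
      · exact hij (h.2.symm.trans h'.2)
    · intro i
      by_cases hi : ∃ t, t ∈ starAt S W v ∧ c t = i
      · obtain ⟨t, ht, hti⟩ := hi
        have : F i ∪ {t | t ∈ starAt S W v ∧ c t = i} = insert t (F i) := by
          ext s
          simp only [Set.mem_union, Set.mem_ofPred_eq, Set.mem_insert_iff]
          constructor
          · rintro (h | h)
            · exact Or.inr h
            · exact Or.inl (hc1 h.1 ht (h.2.trans hti.symm))
          · rintro (rfl | h)
            · exact Or.inr ⟨ht, hti⟩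
            · exact Or.inl h
        change (SimpleGraph.fromEdgeSet (F i ∪ {t | t ∈ starAt S W v ∧ c t = i})).IsAcyclic
        rw [this]
        exact acyclic_insert _ v t (hFv i) ht.2 (hS t ht.1.1) (hFa i)
      · have : F i ∪ {t | t ∈ starAt S W v ∧ c t = i} = F i := by
          ext s
          simp only [Set.mem_union, Set.mem_ofPred_eq, or_iff_left_iff_imp]
          exact fun h => absurd ⟨s, h⟩ hi
        change (SimpleGraph.fromEdgeSet (F i ∪ {t | t ∈ starAt S W v ∧ c t = i})).IsAcyclic
        rw [this]; exact hFa i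
    · rintro hy t (ht | ht) hyt
      · exact hFy hy t ht hyt
      · exact hc2 t ht.1 hyt ht.2

lemma rkk_bdd {V : Type*} [Finite V] (k : ℕ) (E : Set (Sym2 V)) :
    BddAbove {m : ℕ | ∃ F : Finset (Sym2 V), ↑F ⊆ E ∧ PartitionsIntoForests k F ∧ F.card = m} := by
  have := Fintype.ofFinite (Sym2 V)
  refine ⟨Fintype.card (Sym2 V), ?_⟩
  rintro m ⟨F, -, -, rfl⟩
  exact Finset.card_le_univ F

/-- The rank is attained. -/
lemma rkk_attained {V : Type*} [Finite V] (k : ℕ) (E : Set (Sym2 V)) :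
    ∃ F : Fin k → Set (Sym2 V), (∀ i, F i ⊆ E) ∧
      (Pairwise fun i j => Disjoint (F i) (F j)) ∧
      (∀ i, (SimpleGraph.fromEdgeSet (F i)).IsAcyclic) ∧ (⋃ i, F i).ncard = rkk k E := by
  have hmem := Nat.sSup_mem (s := {m : ℕ | ∃ F : Finset (Sym2 V), ↑F ⊆ E ∧
    PartitionsIntoForests k F ∧ F.card = m}) ⟨0, ∅, by simp, ⟨fun _ => ∅, by simp, by simp,
      fun _ _ _ => by simp, by simp⟩, rfl⟩ (rkk_bdd k E)
  obtain ⟨F, hFE, ⟨P, h1, h2, h3, h4⟩, h5⟩ := hmem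
  refine ⟨fun i => ↑(P i), fun i => subset_trans (by exact_mod_cast h1 i) hFE,
    fun i j hij => Finset.disjoint_coe.2 (h3 hij), h4, ?_⟩
  have : (⋃ i, (↑(P i) : Set (Sym2 V))) = ↑F := by
    ext t
    simp only [Set.mem_iUnion, Finset.mem_coe]
    exact ⟨fun ⟨i, hi⟩ => h1 i hi, h2 t⟩
  rw [this, Set.ncard_coe_finset, h5]; rfl

lemma le_rkk {V : Type*} [Finite V] (k : ℕ) (E : Set (Sym2 V)) (F : Fin k → Set (Sym2 V))
    (hsub : (⋃ i, F i) ⊆ E) (hd : Pairwise fun i j => Disjoint (F i) (F j))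
    (ha : ∀ i, (SimpleGraph.fromEdgeSet (F i)).IsAcyclic) : (⋃ i, F i).ncard ≤ rkk k E := by
  classical
  apply le_csSup (rkk_bdd k E)
  refine ⟨(Set.toFinite (⋃ i, F i)).toFinset, by simpa using hsub,
    ⟨fun i => (Set.toFinite (F i)).toFinset, ?_, ?_, ?_, ?_⟩, ?_⟩
  · intro i t ht
    simp only [Set.Finite.mem_toFinset, Set.mem_iUnion] at ht ⊢
    exact ⟨i, ht⟩
  · intro t ht
    simpa using ht
  · intro i j hij
    simpa using hd hij
  · intro i
    simpa using ha i
  · rw [Set.ncard_eq_toFinset_card _ (Set.toFinite _)]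

/-- Star sizes are degrees. -/
lemma starAt_ncard {V : Type*} (S : Set (Sym2 V)) (hS : ∀ e ∈ S, ¬ e.IsDiag) (W : Set V) (v : V)
    (hv : v ∈ W) :
    (starAt S W v).ncard = (W ∩ (SimpleGraph.fromEdgeSet S).neighborSet v).ncard := by
  have : starAt S W v = (fun w => s(v, w)) '' (W ∩ (SimpleGraph.fromEdgeSet S).neighborSet v) := by
    ext t
    constructor
    · rintro ⟨⟨h1, h2⟩, w, rfl⟩
      refine ⟨w, ⟨h2 w (Sym2.mem_mk_right _ _), ?_⟩, rfl⟩
      have := hS _ h1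
      simp only [SimpleGraph.mem_neighborSet, SimpleGraph.fromEdgeSet_adj]
      exact ⟨h1, by simpa using this⟩
    · rintro ⟨w, ⟨h1, h2⟩, rfl⟩
      simp only [SimpleGraph.mem_neighborSet, SimpleGraph.fromEdgeSet_adj] at h2
      refine ⟨⟨h2.1, ?_⟩, Sym2.mem_mk_left _ _⟩
      intro x hx
      rcases Sym2.mem_iff.1 hx with rfl | rfl
      · exact hv
      · exact h1
  rw [this, Set.ncard_image_of_injective]
  intro a b hab
  exact Sym2.congr_right.1 hab

lemma core_deg {V : Type*} [Finite V] (κ : ℕ) (S : Set (Sym2 V)) (hS : ∀ e ∈ S, ¬ e.IsDiag)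
    (v : V) (hv : v ∈ coreSet κ (SimpleGraph.fromEdgeSet S)) :
    κ ≤ (starAt S (coreSet κ (SimpleGraph.fromEdgeSet S)) v).ncard := by
  rw [starAt_ncard S hS _ v hv]
  obtain ⟨D, hD, hvD⟩ := hv
  refine (hD v hvD).trans (Set.ncard_le_ncard ?_ (Set.toFinite _))
  exact Set.inter_subset_inter_left _ (Set.subset_sUnion_of_mem hD)

lemma subset_core {V : Type*} (κ : ℕ) (S : Set (Sym2 V)) (hS : ∀ e ∈ S, ¬ e.IsDiag)
    (W : Set V) (hW : ∀ v ∈ W, κ ≤ (starAt S W v).ncard) :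
    W ⊆ coreSet κ (SimpleGraph.fromEdgeSet S) :=
  Set.subset_sUnion_of_mem (fun v hv => by rw [← starAt_ncard S hS W v hv]; exact hW v hv)

lemma starAt_mono {V : Type*} {S S' : Set (Sym2 V)} {W W' : Set V} (hS : S ⊆ S') (hW : W ⊆ W')
    (v : V) : starAt S W v ⊆ starAt S' W' v :=
  fun _ ht => ⟨⟨hS ht.1.1, fun x hx => hW (ht.1.2 x hx)⟩, ht.2⟩

/-- Degree sum over the new vertices. -/
lemma degree_sum {V : Type*} [Fintype V] (S : Set (Sym2 V)) (hS : ∀ e ∈ S, ¬ e.IsDiag)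
    (C C' : Set V) (U : Finset V) (hU : (↑U : Set V) = C' \ C) :
    ∑ u ∈ U, (starAt S C' u).ncard
      = (edgesIn S C' \ edgesIn S C).ncard + (edgesIn S (C' \ C)).ncard := by
  classical
  have hm : ∀ x, x ∈ U ↔ x ∈ C' ∧ x ∉ C := fun x => by
    rw [← Finset.mem_coe, hU]; rfl
  set X := (Set.toFinite (edgesIn S C' \ edgesIn S C)).toFinset with hX
  have h1 : ∀ u ∈ U, (starAt S C' u).ncard = (X.bipartiteAbove (fun u t => u ∈ t) u).card := by
    intro u hu
    rw [← Set.ncard_coe_finset]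
    congr 1
    ext t
    simp only [Finset.bipartiteAbove, Finset.coe_filter, hX, Set.Finite.mem_toFinset,
      Set.mem_sdiff, Set.mem_ofPred_eq, starAt]
    constructor
    · rintro ⟨h1, h2⟩
      exact ⟨⟨h1, fun h => ((hm u).1 hu).2 (h.2 u h2)⟩, h2⟩
    · rintro ⟨⟨h1, -⟩, h2⟩
      exact ⟨h1, h2⟩
  rw [Finset.sum_congr rfl h1, Finset.sum_card_bipartiteAbove_eq_sum_card_bipartiteBelow]
  have h2 : ∀ t ∈ X, (U.bipartiteBelow (fun u t => u ∈ t) t).card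
      = 1 + if t ∈ edgesIn S (C' \ C) then 1 else 0 := by
    intro t ht
    simp only [hX, Set.Finite.mem_toFinset, Set.mem_sdiff] at ht
    obtain ⟨⟨ht1, ht2⟩, ht3⟩ := ht
    induction t using Sym2.ind with
    | _ a b =>
    have hab : a ≠ b := by simpa using hS _ ht1
    have ha : a ∈ C' := ht2 a (Sym2.mem_mk_left _ _)
    have hb : b ∈ C' := ht2 b (Sym2.mem_mk_right _ _)
    have hnot : ¬ (a ∈ C ∧ b ∈ C) := by
      rintro ⟨h, h'⟩
      exact ht3 ⟨ht1, fun x hx => by rcases Sym2.mem_iff.1 hx with rfl | rfl <;> assumption⟩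
    have hin : s(a, b) ∈ edgesIn S (C' \ C) ↔ a ∉ C ∧ b ∉ C := by
      simp [edgesIn, ht1, ha, hb]
    have hf : U.bipartiteBelow (fun u t => u ∈ t) s(a, b)
        = (if a ∈ C then ∅ else {a}) ∪ (if b ∈ C then ∅ else {b}) := by
      ext x
      simp only [Finset.bipartiteBelow, Finset.mem_filter, hm, Sym2.mem_iff, Finset.mem_union]
      by_cases h : a ∈ C <;> by_cases h' : b ∈ C <;> simp [h, h'] <;> grind
    rw [hf]
    by_cases h : a ∈ C <;> by_cases h' : b ∈ C <;> simp_all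
  rw [Finset.sum_congr rfl h2, Finset.sum_add_distrib, Finset.sum_const, smul_eq_mul, mul_one,
    ← Finset.card_filter, Set.ncard_eq_toFinset_card _ (Set.toFinite _), ← hX]
  congr 1
  rw [← Set.ncard_coe_finset]
  congr 1
  ext t
  simp only [Finset.coe_filter, hX, Set.Finite.mem_toFinset, Set.mem_ofPred_eq, and_iff_right_iff_imp]
  intro h
  refine ⟨⟨h.1, fun x hx => (h.2 x hx).1⟩, fun h' => ?_⟩
  have hne : ∃ x, x ∈ t := by
    induction t using Sym2.ind with
    | _ a b => exact ⟨a, Sym2.mem_mk_left _ _⟩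
  obtain ⟨x, hx⟩ := hne
  exact (h.2 x hx).2 (h'.2 x hx)

/-- Growing a spanning tree. -/
lemma grow_tree {V : Type*} [Finite V] (S : Set (Sym2 V)) (U : Set V) (u0 : V) (hu0 : u0 ∈ U)
    (hcut : ∀ A ⊆ U, A.Nonempty → A ≠ U → ∃ p ∈ A, ∃ q ∈ U, q ∉ A ∧ s(p, q) ∈ S) :
    ∀ n : ℕ, n + 1 ≤ U.ncard → ∃ A ⊆ U, A.ncard = n + 1 ∧ ∃ X ⊆ edgesIn S A, X.ncard ≤ n ∧
      ∀ B ⊆ A, B.Nonempty → B ≠ A → ∃ p ∈ B, ∃ q ∈ A, q ∉ B ∧ s(p, q) ∈ X := by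
  intro n
  induction n with
  | zero =>
    intro _
    refine ⟨{u0}, by simpa using hu0, by simp, ∅, by simp, by simp, ?_⟩
    intro B hB hne hBA
    rcases Set.subset_singleton_iff_eq.1 hB with h | h
    · exact absurd h hne.ne_empty
    · exact absurd h hBA
  | succ n ih =>
    intro hn
    obtain ⟨A, hAU, hA, X, hX, hXn, hc⟩ := ih (by omega)
    have hAne : A.Nonempty := by
      rw [← Set.ncard_pos]; omega
    obtain ⟨p, hp, q, hqU, hqA, hpq⟩ := hcut A hAU hAne (by rintro rfl; omega)
    refine ⟨insert q A, Set.insert_subset hqU hAU, by rw [Set.ncard_insert_of_notMem hqA, hA],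
      insert s(p, q) X, ?_, ?_, ?_⟩
    · intro t ht
      rcases ht with rfl | ht
      · refine ⟨hpq, fun x hx => ?_⟩
        rcases Sym2.mem_iff.1 hx with rfl | rfl
        · exact Or.inr hp
        · exact Or.inl rfl
      · exact ⟨(hX ht).1, fun x hx => Or.inr ((hX ht).2 x hx)⟩
    · exact (Set.ncard_insert_le _ _).trans (by omega)
    · intro B hB hne hBA
      by_cases h1 : (B ∩ A).Nonempty
      · by_cases h2 : B ∩ A = A
        · have hAB : A ⊆ B := Set.inter_eq_right.1 h2
          have hqB : q ∉ B := fun h => hBA (subset_antisymm hB (Set.insert_subset h hAB))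
          exact ⟨p, hAB hp, q, Or.inl rfl, hqB, Or.inl rfl⟩
        · obtain ⟨a, ha, b, hb, hbn, hab⟩ := hc (B ∩ A) Set.inter_subset_right h1 h2
          exact ⟨a, ha.1, b, Or.inr hb, fun h => hbn ⟨h, hb⟩, Or.inr hab⟩
      · obtain ⟨x, hx⟩ := hne
        have hxq : x = q := by
          rcases hB hx with h | h
          · exact h
          · exact absurd ⟨x, hx, h⟩ h1
        subst hxq
        exact ⟨x, hx, p, Or.inr hp, fun h => h1 ⟨p, h, hp⟩, Or.inl Sym2.eq_swap⟩

/-- Summary of `extend_forests` on the whole of `C'`, starting from an optimal base. -/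
lemma extend_whole {V : Type*} [Finite V] (k : ℕ) (hk : 2 ≤ k) (i0 : Fin k)
    (E S : Set (Sym2 V)) (hS : ∀ e ∈ S, ¬ e.IsDiag) (C C' : Set V) (hCC : C ⊆ C') (y : V)
    (hES : edgesIn E C ⊆ edgesIn S C)
    (Q : ∀ W, C ⊂ W → W ⊆ C' → ∃ v ∈ W, v ∉ C ∧ (starAt S W v).ncard ≤ k ∧
      (v = y → (starAt S W v).ncard ≤ k - 1)) :
    ∃ F : Fin k → Set (Sym2 V),
      (⋃ i, F i) ⊆ edgesIn S C' ∧
      (⋃ i, F i).ncard = rkk k (edgesIn E C) + (edgesIn S C' \ edgesIn S C).ncard ∧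
      (Pairwise fun i j => Disjoint (F i) (F j)) ∧
      (∀ i, (SimpleGraph.fromEdgeSet (F i)).IsAcyclic) ∧
      (y ∉ C → ∀ t ∈ F i0, y ∉ t) := by
  obtain ⟨F0, h1, h2, h3, h4⟩ := rkk_attained k (edgesIn E C)
  obtain ⟨F, g1, g2, g3, g4⟩ := extend_forests k hk i0 S hS C C' y F0
    (fun i => (h1 i).trans hES) h2 h3 Q C'.ncard C' hCC subset_rfl rfl
  have hsub : (⋃ i, F0 i) ⊆ edgesIn S C := Set.iUnion_subset fun i => (h1 i).trans hES
  refine ⟨F, ?_, ?_, g2, g3, g4⟩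
  · rw [g1]
    refine Set.union_subset (fun t ht => ?_) Set.sdiff_subset
    exact ⟨(hsub ht).1, fun x hx => hCC ((hsub ht).2 x hx)⟩
  · rw [g1, Set.ncard_union_eq _ (Set.toFinite _) (Set.toFinite _), h4]
    exact Set.disjoint_left.2 fun t ht ht' => ht'.2 (hsub ht)

theorem stmt13 {V : Type*} [Fintype V] (k : ℕ) (hk : 2 ≤ k)
    (E : Set (Sym2 V)) (hE : ∀ e ∈ E, ¬ e.IsDiag)
    (e : Sym2 V) (he : ¬ e.IsDiag) (heE : e ∉ E)
    (C C' : Set V)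
    (hC : C = coreSet (k + 1) (SimpleGraph.fromEdgeSet E))
    (hC' : C' = coreSet (k + 1) (SimpleGraph.fromEdgeSet (insert e E)))
    (hCne : C.Nonempty)
    (V₁ E₁ Δ : ℤ)
    (hV₁ : V₁ = (C'.ncard : ℤ) - (C.ncard : ℤ))
    (hE₁ : E₁ = ((edgesIn (insert e E) (C' \ C)).ncard : ℤ))
    (hΔ : Δ = (rkk k (edgesIn (insert e E) C') : ℤ) - (rkk k (edgesIn E C) : ℤ))
    (hpos : 0 < k * V₁ - Δ) :
    k * V₁ - Δ ≤ E₁ - V₁ := by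
  classical
  by_contra hcon
  set S := insert e E with hSdef
  have hES : E ⊆ S := Set.subset_insert _ _
  have hS : ∀ t ∈ S, ¬ t.IsDiag := by
    rintro t (rfl | ht)
    · exact he
    · exact hE t ht
  have hCdeg : ∀ v ∈ C, k + 1 ≤ (starAt E C v).ncard := by
    rw [hC]; exact fun v hv => core_deg _ _ hE v hv
  have hCmax : ∀ W : Set V, (∀ v ∈ W, k + 1 ≤ (starAt E W v).ncard) → W ⊆ C := by
    rw [hC]; exact fun W hW => subset_core _ _ hE W hW
  have hCdeg' : ∀ v ∈ C', k + 1 ≤ (starAt S C' v).ncard := by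
    rw [hC']; exact fun v hv => core_deg _ _ hS v hv
  have hCC : C ⊆ C' := by
    rw [hC']
    exact subset_core _ _ hS C fun v hv => (hCdeg v hv).trans
      (Set.ncard_le_ncard (starAt_mono hES subset_rfl v) (Set.toFinite _))
  clear hC hC'
  let i0 : Fin k := ⟨0, by omega⟩
  obtain ⟨y0, hy0⟩ := hCne
  -- a set which extends `C` by vertices of large degree is inside `C`
  have hCmax' : ∀ W : Set V, C ⊆ W → (∀ v ∈ W, v ∉ C → k + 1 ≤ (starAt E W v).ncard) → W ⊆ C := by
    intro W hCW h
    apply hCmax W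
    intro v hv
    by_cases hvC : v ∈ C
    · exact (hCdeg v hvC).trans
        (Set.ncard_le_ncard (starAt_mono subset_rfl hCW v) (Set.toFinite _))
    · exact h v hv hvC
  set N := (edgesIn S C' \ edgesIn S C).ncard with hN
  -- First bound
  have hA : 0 ≤ Δ ∧ (N : ℤ) - 1 ≤ Δ := by
    obtain ⟨F, g1, g2, g3, g4, -⟩ := extend_whole k hk i0 E E hE C C' hCC y0 subset_rfl (by
      intro W hCW hWC
      by_contra hno
      push Not at hno
      apply hCW.2
      apply hCmax' W hCW.1
      intro v hv hvC
      by_contra hlt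
      have := hno v hv hvC (by omega)
      exact hvC (this.1 ▸ hy0))
    have hle := le_rkk k (edgesIn S C') F
      (g1.trans fun t ht => ⟨hES ht.1, ht.2⟩) g3 g4
    have hN' : N ≤ (edgesIn E C' \ edgesIn E C).ncard + 1 := by
      refine le_trans (Set.ncard_le_ncard ?_ (Set.toFinite _)) (Set.ncard_insert_le e _)
      rintro t ⟨⟨h1, h2⟩, h3⟩
      rcases h1 with rfl | h1
      · exact Or.inl rfl
      · exact Or.inr ⟨⟨h1, h2⟩, fun h => h3 ⟨hES h.1, h.2⟩⟩
    omega
  -- counting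
  let U : Finset V := (Set.toFinite (C' \ C)).toFinset
  have hUm : ∀ x, x ∈ U ↔ x ∈ C' ∧ x ∉ C := fun x => by simp [U]
  have hUc : (↑U : Set V) = C' \ C := by simp [U]
  have hsum := degree_sum S hS C C' U hUc
  have hUn : (C' \ C).ncard = U.card := by rw [← hUc, Set.ncard_coe_finset]
  have hV : V₁ = (U.card : ℤ) := by
    have := Set.ncard_sdiff_add_ncard_of_subset hCC
    omega
  have hsumge : (k + 1) * U.card ≤ ∑ u ∈ U, (starAt S C' u).ncard := by
    rw [mul_comm]
    exact Finset.card_nsmul_le_sum U _ _ fun u hu => hCdeg' u ((hUm u).1 hu).1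
  have hk1 : ((k + 1) * U.card : ℕ) = (k : ℤ) * V₁ + V₁ := by
    rw [hV]; push_cast; ring
  have hsumeq : ∑ u ∈ U, (starAt S C' u).ncard = (k + 1) * U.card := by omega
  have hdeg : ∀ u ∈ U, (starAt S C' u).ncard = k + 1 := by
    have h0 : ∑ u ∈ U, (k + 1) = ∑ u ∈ U, (starAt S C' u).ncard := by
      rw [hsumeq]; simp [mul_comm]
    have := (Finset.sum_eq_sum_iff_of_le (fun u hu => hCdeg' u ((hUm u).1 hu).1)).1 h0
    exact fun u hu => (this u hu).symm
  have hE1 : (U.card : ℤ) ≤ (edgesIn S (C' \ C)).ncard := by omega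
  have hΔN : Δ < N := by omega
  -- `U` is nonempty
  have hUpos : 0 < U.card := by
    rcases Nat.eq_zero_or_pos U.card with h | h
    · rw [h] at hV
      simp only [Nat.cast_zero] at hV
      rw [hV] at hpos
      simp at hpos
      omega
    · exact h
  obtain ⟨u0, hu0⟩ := Finset.card_pos.1 hUpos
  -- cuts
  have hside : ∀ A : Set V, A ⊆ C' \ C → A.Nonempty → (∀ x ∈ A, x ∉ e) →
      ∃ p ∈ A, ∃ q ∈ C' \ C, q ∉ A ∧ s(p, q) ∈ S := by
    intro A hAU hAne hAe
    by_contra hno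
    push Not at hno
    have : C ∪ A ⊆ C := by
      apply hCmax' _ Set.subset_union_left
      intro v hv hvC
      have hvA : v ∈ A := hv.resolve_left hvC
      have hst : starAt S C' v ⊆ starAt E (C ∪ A) v := by
        rintro t ⟨⟨h1, h2⟩, w, rfl⟩
        have hE' : s(v, w) ∈ E := by
          rcases h1 with h1 | h1
          · exact absurd (h1 ▸ Sym2.mem_mk_left v w) (hAe v hvA)
          · exact h1
        refine ⟨⟨hE', ?_⟩, Sym2.mem_mk_left _ _⟩
        intro x hx
        rcases Sym2.mem_iff.1 hx with rfl | rfl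
        · exact hv
        · by_contra hx'
          exact hno v hvA x ⟨h2 x (Sym2.mem_mk_right _ _), fun h => hx' (Or.inl h)⟩
            (fun h => hx' (Or.inr h)) h1
      exact (hCdeg' v (hAU hvA).1).trans (Set.ncard_le_ncard hst (Set.toFinite _))
    obtain ⟨a, ha⟩ := hAne
    exact (hAU ha).2 (this (Or.inr ha))
  have hcut : ∀ A ⊆ C' \ C, A.Nonempty → A ≠ C' \ C →
      ∃ p ∈ A, ∃ q ∈ C' \ C, q ∉ A ∧ s(p, q) ∈ S := by
    intro A hAU hAne hAU'
    by_cases h1 : ∀ x ∈ A, x ∉ e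
    · exact hside A hAU hAne h1
    push Not at h1
    obtain ⟨a, haA, hae⟩ := h1
    by_cases h2 : ∀ x ∈ (C' \ C) \ A, x ∉ e
    · obtain ⟨p, hp, q, hq, hqA, hpq⟩ := hside ((C' \ C) \ A) Set.sdiff_subset
        (Set.nonempty_of_ssubset (lt_of_le_of_ne hAU hAU')) h2
      have hqA' : q ∈ A := by
        by_contra h
        exact hqA ⟨hq, h⟩
      exact ⟨q, hqA', p, hp.1, hp.2, by rw [Sym2.eq_swap]; exact hpq⟩
    push Not at h2
    obtain ⟨b, hb, hbe⟩ := h2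
    have hab : a ≠ b := fun h => hb.2 (h ▸ haA)
    have : e = s(a, b) := (Sym2.mem_and_mem_iff hab).1 ⟨hae, hbe⟩
    exact ⟨a, haA, b, hb.1, hb.2, Or.inl this.symm⟩
  -- spanning tree and an edge outside
  obtain ⟨A, hAU, hAn, X, hX, hXn, hXcut⟩ := grow_tree S (C' \ C) u0 ((hUm u0).1 hu0) hcut
    (U.card - 1) (by omega)
  have hAeq : A = C' \ C := Set.eq_of_subset_of_ncard_le hAU (by omega) (Set.toFinite _)
  subst hAeq
  obtain ⟨f, hf, hfX⟩ : ∃ f ∈ edgesIn S (C' \ C), f ∉ X := by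
    by_contra h
    push Not at h
    have := Set.ncard_le_ncard (s := edgesIn S (C' \ C)) (t := X) h (Set.toFinite _)
    omega
  clear hcut hside
  induction f using Sym2.ind with
  | _ p y =>
  have hpy : p ≠ y := by simpa using hS _ hf.1
  have hpU := hf.2 p (Sym2.mem_mk_left _ _)
  have hyU := hf.2 y (Sym2.mem_mk_right _ _)
  have hSf : ∀ t ∈ S \ {s(p, y)}, ¬ t.IsDiag := fun t ht => hS t ht.1
  have hsubC : edgesIn E C ⊆ edgesIn (S \ {s(p, y)}) C := by
    rintro t ⟨h1, h2⟩
    refine ⟨⟨hES h1, ?_⟩, h2⟩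
    rintro rfl
    exact hpU.2 (h2 p (Sym2.mem_mk_left _ _))
  obtain ⟨F, g1, g2, g3, g4, g5⟩ := extend_whole k hk i0 E (S \ {s(p, y)}) hSf C C' hCC y hsubC (by
    intro W hCW hWC
    by_cases hW : W = C'
    · subst hW
      refine ⟨p, hpU.1, hpU.2, ?_, fun h => absurd h hpy⟩
      have hst : starAt (S \ {s(p, y)}) W p ⊆ starAt S W p \ {s(p, y)} :=
        fun t ht => ⟨⟨⟨ht.1.1.1, ht.1.2⟩, ht.2⟩, ht.1.1.2⟩
      have h1 := Set.ncard_le_ncard hst (Set.toFinite _)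
      have hm : s(p, y) ∈ starAt S W p :=
        ⟨⟨hf.1, fun x hx => (hf.2 x hx).1⟩, Sym2.mem_mk_left _ _⟩
      rw [Set.ncard_sdiff_singleton_of_mem hm,
        hdeg p ((hUm p).2 hpU)] at h1
      omega
    · obtain ⟨a, ha, b, hb, hbn, hab⟩ := hXcut (W \ C) (fun x hx => ⟨hWC hx.1, hx.2⟩)
        (Set.nonempty_of_ssubset hCW) (by
          intro h
          apply hW
          apply subset_antisymm hWC
          intro x hx
          by_cases hxC : x ∈ C
          · exact hCW.1 hxC
          · have : x ∈ C' \ C := ⟨hx, hxC⟩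
            rw [← h] at this
            exact this.1)
      have hbW : b ∉ W := fun h => hbn ⟨h, hb.2⟩
      have haU : a ∈ C' \ C := ⟨hWC ha.1, ha.2⟩
      have habm : s(a, b) ∈ starAt S C' a :=
        ⟨⟨(hX hab).1, fun x hx => ((hX hab).2 x hx).1⟩, Sym2.mem_mk_left _ _⟩
      have hst : starAt (S \ {s(p, y)}) W a ⊆ (starAt S C' a \ {s(a, b)}) \ {s(p, y)} := by
        intro t ht
        refine ⟨⟨⟨⟨ht.1.1.1, fun x hx => hWC (ht.1.2 x hx)⟩, ht.2⟩, ?_⟩, ht.1.1.2⟩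
        rintro rfl
        exact hbW (ht.1.2 b (Sym2.mem_mk_right _ _))
      have h1 := Set.ncard_le_ncard hst (Set.toFinite _)
      have h2 : (starAt S C' a \ {s(a, b)}).ncard = k := by
        rw [Set.ncard_sdiff_singleton_of_mem habm, hdeg a ((hUm a).2 haU)]; omega
      refine ⟨a, ha.1, ha.2, ?_, ?_⟩
      · have := Set.ncard_sdiff_singleton_le (starAt S C' a \ {s(a, b)}) s(p, y)
        omega
      · rintro rfl
        have hm : s(p, a) ∈ starAt S C' a \ {s(a, b)} := by
          refine ⟨⟨⟨hf.1, fun x hx => (hf.2 x hx).1⟩, Sym2.mem_mk_right _ _⟩, ?_⟩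
          intro h
          rw [Set.mem_singleton_iff] at h
          exact hfX (h ▸ hab)
        rw [Set.ncard_sdiff_singleton_of_mem hm, h2] at h1
        exact h1)
  -- add the last edge
  have hfF : ∀ i, s(p, y) ∉ F i := by
    intro i h
    exact (g1 (Set.mem_iUnion.2 ⟨i, h⟩)).1.2 rfl
  let F' : Fin k → Set (Sym2 V) := fun i => if i = i0 then insert s(p, y) (F i) else F i
  have hF'sub : ∀ i, F' i ⊆ insert s(p, y) (F i) := by
    intro i
    by_cases h : i = i0
    · simp [F', h]
    · simp [F', h]
  have hU' : (⋃ i, F' i) = insert s(p, y) (⋃ i, F i) := by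
    ext t
    simp only [Set.mem_iUnion, Set.mem_insert_iff]
    constructor
    · rintro ⟨i, hi⟩
      rcases hF'sub i hi with h | h
      · exact Or.inl h
      · exact Or.inr ⟨i, h⟩
    · rintro (rfl | ⟨i, hi⟩)
      · exact ⟨i0, by simp [F']⟩
      · refine ⟨i, ?_⟩
        by_cases h : i = i0
        · simp only [F', h, if_true]; rw [h] at hi; exact Or.inr hi
        · simpa [F', h] using hi
  have hle := le_rkk k (edgesIn S C') F' (by
      rw [hU']
      apply Set.insert_subset
      · exact ⟨hf.1, fun x hx => (hf.2 x hx).1⟩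
      · exact g1.trans fun t ht => ⟨ht.1.1, ht.2⟩)
    (by
      intro i j hij
      have hd := Set.disjoint_left.1 (g3 hij)
      rw [Set.disjoint_left]
      intro t hi hj
      by_cases h : i = i0
      · have h' : j ≠ i0 := fun h' => hij (h.trans h'.symm)
        simp only [F', h', if_false] at hj
        rcases hF'sub i hi with rfl | hi
        · exact hfF j hj
        · exact hd hi hj
      · simp only [F', h, if_false] at hi
        rcases hF'sub j hj with rfl | hj
        · exact hfF i hi
        · exact hd hi hj)
    (by
      intro i
      by_cases h : i = i0
      · simp only [F', h, if_true]
        exact acyclic_insert _ y _ (g5 hyU.2) (Sym2.mem_mk_right _ _) (hS _ hf.1) (g4 i0)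
      · simpa only [F', h, if_false] using g4 i)
  rw [hU', Set.ncard_insert_of_notMem (by simpa using hfF) (Set.toFinite _), g2] at hle
  have hN' : N ≤ (edgesIn (S \ {s(p, y)}) C' \ edgesIn (S \ {s(p, y)}) C).ncard + 1 := by
    refine le_trans (Set.ncard_le_ncard ?_ (Set.toFinite _)) (Set.ncard_insert_le s(p, y) _)
    rintro t ⟨⟨h1, h2⟩, h3⟩
    by_cases ht : t = s(p, y)
    · exact Or.inl ht
    · exact Or.inr ⟨⟨⟨h1, ht⟩, h2⟩, fun h => h3 ⟨h.1.1, h.2⟩⟩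
  omega
end

section
/- Fix an integer k ≥ 2. For every c > c'_k the function r_k(c) = c − λ_{k+1}(2c)·π_k(λ_{k+1}(2c))/2 + k·π_{k+1}(λ_{k+1}(2c)) is differentiable and satisfies d/dc r_k(c) = 1 − β_k(2c)², where β_k(c) = λ_{k+1}(c)/c. Moreover, for c > 2c'_k, β_k(c) is the largest root β of the equation β = Pr[Pois(βc) ≥ k]. -/
open MeasureTheory Filter

namespace S15

lemma hasSum_congr' {f g : ℕ → ℝ} {a : ℝ} (h : HasSum f a) (hfg : ∀ i, g i = f i) :
    HasSum g a := by
  rw [funext hfg]; exact h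

lemma hasSum_e (x : ℝ) : HasSum (fun i : ℕ => x ^ i / (Nat.factorial i)) (Real.exp x) := by
  rw [Real.exp_eq_exp_ℝ]
  exact NormedSpace.expSeries_div_hasSum_exp x

lemma hasSum_S (k : ℕ) (x : ℝ) :
    HasSum (fun i : ℕ => if k ≤ i then x ^ i / (Nat.factorial i) else 0)
      (Real.exp x - ∑ i ∈ Finset.range k, x ^ i / (Nat.factorial i)) := by
  have h1 := hasSum_e x
  have h2 : HasSum (fun i : ℕ => if i ∈ Finset.range k then x ^ i / (Nat.factorial i : ℝ) else 0)
      (∑ i ∈ Finset.range k, x ^ i / (Nat.factorial i)) := by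
    have e : ∑ i ∈ Finset.range k, x ^ i / (Nat.factorial i : ℝ) = ∑ i ∈ Finset.range k,
        (if i ∈ Finset.range k then x ^ i / (Nat.factorial i : ℝ) else 0) := by
      apply Finset.sum_congr rfl
      intro i hi
      simp only [hi, if_true]
    rw [e]
    apply hasSum_sum_of_ne_finset_zero
    intro b hb
    simp only [hb, if_false]
  refine hasSum_congr' (h1.sub h2) ?_
  intro i
  by_cases h : k ≤ i
  · simp [h, not_lt.mpr h]
  · simp [h, not_le.mp h]

lemma sumFrom_eq (k : ℕ) (x : ℝ) :
    sumFrom k x = Real.exp x - ∑ i ∈ Finset.range k, x ^ i / (Nat.factorial i) :=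
  (hasSum_S k x).tsum_eq

lemma hasSum_sF (k : ℕ) (x : ℝ) :
    HasSum (fun i : ℕ => if k ≤ i then x ^ i / (Nat.factorial i) else 0) (sumFrom k x) := by
  rw [sumFrom_eq]; exact hasSum_S k x

lemma ptail_eq' (k : ℕ) (x : ℝ) : ptail k x = Real.exp (-x) * sumFrom k x := by
  have := ((hasSum_sF k x).mul_left (Real.exp (-x))).tsum_eq
  rw [← this]
  unfold ptail
  congr 1
  funext i
  split_ifs <;> ring

lemma ptail_eq (k : ℕ) (x : ℝ) :
    ptail k x = 1 - Real.exp (-x) * ∑ i ∈ Finset.range k, x ^ i / (Nat.factorial i) := by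
  rw [ptail_eq', sumFrom_eq, mul_sub, ← Real.exp_add]; simp

lemma sumFrom_succ (k : ℕ) (x : ℝ) :
    sumFrom k x = sumFrom (k + 1) x + x ^ k / (Nat.factorial k) := by
  rw [sumFrom_eq, sumFrom_eq, Finset.sum_range_succ]; ring

lemma ptail_succ (k : ℕ) (x : ℝ) :
    ptail k x = ptail (k + 1) x + Real.exp (-x) * (x ^ k / (Nat.factorial k)) := by
  rw [ptail_eq', ptail_eq', sumFrom_succ]; ring

lemma ptail_contDiff (k : ℕ) : ContDiff ℝ 1 (ptail k) := by
  have : ptail k = fun x => 1 - Real.exp (-x) * ∑ i ∈ Finset.range k, x ^ i / (Nat.factorial i) :=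
    funext (ptail_eq k)
  rw [this]
  fun_prop

lemma ptail_deriv (k : ℕ) (x : ℝ) :
    HasDerivAt (ptail (k + 1)) (Real.exp (-x) * (x ^ k / (Nat.factorial k))) x := by
  induction k with
  | zero =>
    have : ptail (0 + 1) = fun x => 1 - Real.exp (-x) := by
      funext y; rw [ptail_eq]; simp
    rw [this]
    have h := ((hasDerivAt_neg x).exp).const_sub 1
    refine h.congr_deriv ?_
    simp
  | succ n ih =>
    have : ptail (n + 1 + 1) = fun x => ptail (n + 1) x -
        Real.exp (-x) * (x ^ (n + 1) / (Nat.factorial (n + 1))) := by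
      funext y; rw [ptail_succ (n + 1)]; ring
    rw [this]
    have h := ih.sub (((hasDerivAt_neg x).exp).mul
      ((hasDerivAt_pow (n + 1) x).div_const ((Nat.factorial (n + 1) : ℕ) : ℝ)))
    refine h.congr_deriv ?_
    have h1 : ((Nat.factorial (n + 1) : ℕ) : ℝ) = (n + 1) * (Nat.factorial n) := by
      rw [Nat.factorial_succ]; push_cast; ring
    have h2 : ((Nat.factorial n : ℕ) : ℝ) ≠ 0 := by positivity
    have h3 : (n : ℝ) + 1 ≠ 0 := by positivity
    rw [h1]
    push_cast
    field_simp
    simp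

lemma ptail_le_one (k : ℕ) {x : ℝ} (hx : 0 ≤ x) : ptail k x ≤ 1 := by
  rw [ptail_eq]
  have : 0 ≤ Real.exp (-x) * ∑ i ∈ Finset.range k, x ^ i / (Nat.factorial i) := by positivity
  linarith

lemma sumFrom_pos (k : ℕ) {x : ℝ} (hx : 0 < x) : 0 < sumFrom k x := by
  have h : ∀ j, 0 ≤ sumFrom j x := fun j => by
    apply tsum_nonneg
    intro i
    split_ifs <;> positivity
  rw [sumFrom_succ]
  have := h (k + 1)
  positivity

lemma ptail_pos (k : ℕ) {x : ℝ} (hx : 0 < x) : 0 < ptail k x := by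
  rw [ptail_eq']
  exact mul_pos (Real.exp_pos _) (sumFrom_pos k hx)

/-- Scaling of tail sums. -/
lemma sumFrom_scale (k : ℕ) {x y : ℝ} (hx : 0 < x) (hxy : x ≤ y) :
    sumFrom k x ≤ (x / y) ^ k * sumFrom k y := by
  have hy : 0 < y := hx.trans_le hxy
  refine hasSum_le ?_ (hasSum_sF k x) ((hasSum_sF k y).mul_left ((x / y) ^ k))
  intro i
  by_cases h : k ≤ i
  · simp only [h, if_true]
    have h1 : x ^ i = (x / y) ^ i * y ^ i := by rw [div_pow]; field_simp
    rw [h1, mul_div_assoc]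
    apply mul_le_mul_of_nonneg_right _ (by positivity)
    exact pow_le_pow_of_le_one (by positivity) ((div_le_one hy).2 hxy) h
  · simp [h]

/-- Series for `2k S_k(x) - x S_{k-1}(x)`. -/
lemma hasSum_D (n : ℕ) (x : ℝ) :
    HasSum (fun i : ℕ => if n + 1 ≤ i then (2 * ((n : ℝ) + 1) - i) * (x ^ i / (Nat.factorial i)) else 0)
      (2 * ((n : ℝ) + 1) * sumFrom (n + 1) x - x * sumFrom n x) := by
  have h1 := (hasSum_sF (n + 1) x).mul_left (2 * ((n : ℝ) + 1))
  have h2 : HasSum (fun i : ℕ => if n + 1 ≤ i then (i : ℝ) * (x ^ i / (Nat.factorial i)) else 0)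
      (x * sumFrom n x) := by
    have h := (hasSum_sF n x).mul_left x
    rw [← hasSum_nat_add_iff' 1]
    simp only [Finset.range_one, Finset.sum_singleton]
    simp only [nonpos_iff_eq_zero, Nat.add_eq_zero_iff, one_ne_zero, and_false, if_false, sub_zero]
    refine hasSum_congr' h ?_
    intro i
    by_cases hi : n ≤ i
    · simp only [hi, add_le_add_iff_right, if_true]
      have h1 : ((Nat.factorial (i + 1) : ℕ) : ℝ) = (i + 1) * (Nat.factorial i) := by
        rw [Nat.factorial_succ]; push_cast; ring
      have h2 : ((Nat.factorial i : ℕ) : ℝ) ≠ 0 := by positivity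
      have h3 : (i : ℝ) + 1 ≠ 0 := by positivity
      rw [h1]; push_cast; field_simp; ring
    · simp [hi]
  refine hasSum_congr' (h1.sub h2) ?_
  intro i
  split_ifs <;> ring

lemma D_scale (n : ℕ) {x y : ℝ} (hx : 0 < x) (hxy : x ≤ y) :
    (x / y) ^ (2 * (n + 1)) * (2 * ((n : ℝ) + 1) * sumFrom (n + 1) y - y * sumFrom n y) ≤
    2 * ((n : ℝ) + 1) * sumFrom (n + 1) x - x * sumFrom n x := by
  have hy : 0 < y := hx.trans_le hxy
  refine hasSum_le ?_ ((hasSum_D n y).mul_left _) (hasSum_D n x)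
  intro i
  have h1 : x ^ i = (x / y) ^ i * y ^ i := by rw [div_pow]; field_simp
  have hr0 : 0 ≤ x / y := by positivity
  have hr1 : x / y ≤ 1 := (div_le_one hy).2 hxy
  by_cases h : n + 1 ≤ i
  · simp only [h, if_true]
    have e : (2 * ((n : ℝ) + 1) - i) * (x ^ i / (Nat.factorial i)) =
      (x / y) ^ i * ((2 * ((n : ℝ) + 1) - i) * (y ^ i / (Nat.factorial i))) := by rw [h1]; ring
    rw [e]
    have hp : 0 ≤ y ^ i / (Nat.factorial i : ℝ) := by positivity
    rcases le_total i (2 * (n + 1)) with h2 | h2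
    · have h3 : (i : ℝ) ≤ 2 * ((n : ℝ) + 1) := by exact_mod_cast h2
      exact mul_le_mul_of_nonneg_right (pow_le_pow_of_le_one hr0 hr1 h2)
        (mul_nonneg (by linarith) hp)
    · have h3 : 2 * ((n : ℝ) + 1) ≤ i := by exact_mod_cast h2
      exact mul_le_mul_of_nonpos_right (pow_le_pow_of_le_one hr0 hr1 h2)
        (mul_nonpos_of_nonpos_of_nonneg (by linarith) hp)
  · simp [h]

/-- lower bound for tail sums by six terms -/
lemma six (k : ℕ) {y : ℝ} (hy : 0 < y) :
    y ^ k / (Nat.factorial k) * (1 + y / (k + 1) * (1 + y / (k + 2) * (1 + y / (k + 3) *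
      (1 + y / (k + 4) * (1 + y / (k + 5)))))) < sumFrom k y := by
  have h6 := sumFrom_pos (k + 6) hy
  rw [sumFrom_succ, sumFrom_succ (k + 1), sumFrom_succ (k + 2), sumFrom_succ (k + 3),
    sumFrom_succ (k + 4), sumFrom_succ (k + 5)]
  have hf : ((Nat.factorial k : ℕ) : ℝ) ≠ 0 := by positivity
  have g : ∀ i, y ^ (i + 1) / (Nat.factorial (i + 1) : ℝ) =
      y ^ i / (Nat.factorial i : ℝ) * (y / ((i : ℝ) + 1)) := by
    intro i
    have h1 : ((Nat.factorial (i + 1) : ℕ) : ℝ) = (i + 1) * (Nat.factorial i) := by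
      rw [Nat.factorial_succ]; push_cast; ring
    have h2 : ((Nat.factorial i : ℕ) : ℝ) ≠ 0 := by positivity
    have h3 : (i : ℝ) + 1 ≠ 0 := by positivity
    rw [h1, pow_succ]; field_simp
  rw [g (k + 4), g (k + 3), g (k + 2), g (k + 1), g k]
  push_cast
  have e2 : (k : ℝ) + 1 + 1 = k + 2 := by ring
  have e3 : (k : ℝ) + 2 + 1 = k + 3 := by ring
  have e4 : (k : ℝ) + 3 + 1 = k + 4 := by ring
  have e5 : (k : ℝ) + 4 + 1 = k + 5 := by ring
  rw [e2, e3, e4, e5]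
  nlinarith [h6]

/-- lower bound on the threshold -/
lemma m_low (n : ℕ) (m y : ℝ) (hm : 0 < m) (hy : 0 < y)
    (hD : m * sumFrom n m = 2 * ((n : ℝ) + 1) * sumFrom (n + 1) m)
    (hy2 : y < 2 * ((n : ℝ) + 1))
    (h : ((n : ℝ) + 1) ≤ (2 * ((n : ℝ) + 1) - y) * (1 + y / (n + 2) * (1 + y / (n + 3) * (1 + y / (n + 4) *
      (1 + y / (n + 5) * (1 + y / (n + 6))))))) : y < m := by
  by_contra hcon
  have hs := D_scale n hm (not_lt.mp hcon)
  have h6 := six (n + 1) hy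
  have hpos : 0 < 2 * ((n : ℝ) + 1) * sumFrom (n + 1) y - y * sumFrom n y := by
    rw [sumFrom_succ n]
    have h1 : ((Nat.factorial (n + 1) : ℕ) : ℝ) = (n + 1) * (Nat.factorial n) := by
      rw [Nat.factorial_succ]; push_cast; ring
    have h2 : (0 : ℝ) < ((Nat.factorial n : ℕ) : ℝ) := by positivity
    have h3 : (0 : ℝ) < (n : ℝ) + 1 := by positivity
    push_cast at h6
    have e2 : (n : ℝ) + 1 + 1 = n + 2 := by ring
    have e3 : (n : ℝ) + 1 + 2 = n + 3 := by ring
    have e4 : (n : ℝ) + 1 + 3 = n + 4 := by ring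
    have e5 : (n : ℝ) + 1 + 4 = n + 5 := by ring
    have e6 : (n : ℝ) + 1 + 5 = n + 6 := by ring
    rw [e2, e3, e4, e5, e6] at h6
    set Q := (1 + y / ((n : ℝ) + 2) * (1 + y / (n + 3) * (1 + y / (n + 4) *
      (1 + y / (n + 5) * (1 + y / (n + 6)))))) with hQ
    have h7 := mul_lt_mul_of_pos_left h6 (sub_pos.2 hy2)
    have h8 := mul_le_mul_of_nonneg_left h
      (show 0 ≤ y ^ (n + 1) / ((Nat.factorial (n + 1) : ℕ) : ℝ) by positivity)
    have h9 : y ^ (n + 1) / ((Nat.factorial (n + 1) : ℕ) : ℝ) * ((n : ℝ) + 1)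
        = y * (y ^ n / ((Nat.factorial n : ℕ) : ℝ)) := by
      rw [h1, pow_succ]; field_simp
    nlinarith
  have hp : 0 < (m / y) ^ (2 * (n + 1)) := by positivity
  have := mul_pos hp hpos
  linarith

lemma moment (k : ℕ) (m : ℝ) (hm : 0 < m) (hk : 1 ≤ k) (h : 3 * ((k : ℝ) * (k + 1)) ≤ m ^ 2) :
    ∃ l : ℝ, 0 < l ∧ l ≤ m * ptail k l := by
  by_contra hcon
  push Not at hcon
  obtain ⟨n, rfl⟩ : ∃ n, k = n + 1 := ⟨k - 1, by omega⟩
  let Φ : ℝ → ℝ := fun T => T ^ 3 / (3 * m) - T ^ 2 * ptail (n + 1) T / 2 +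
    ((n : ℝ) + 1) * (n + 2) / 2 * ptail (n + 3) T
  have hd : ∀ T, HasDerivAt Φ (T * (T / m - ptail (n + 1) T)) T := by
    intro T
    have h1 := (((hasDerivAt_pow 3 T).div_const (3 * m)).sub
      (((hasDerivAt_pow 2 T).mul (ptail_deriv n T)).div_const 2)).add
      ((ptail_deriv (n + 2) T).const_mul (((n : ℝ) + 1) * (n + 2) / 2))
    refine h1.congr_deriv ?_
    have h1 : ((Nat.factorial (n + 2) : ℕ) : ℝ) = (n + 2) * ((n + 1) * (Nat.factorial n)) := by
      rw [Nat.factorial_succ, Nat.factorial_succ]; push_cast; ring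
    have h2 : ((Nat.factorial n : ℕ) : ℝ) ≠ 0 := by positivity
    have h3 : (n : ℝ) + 1 ≠ 0 := by positivity
    have h4 : (n : ℝ) + 2 ≠ 0 := by positivity
    rw [h1]; field_simp; ring
  have hmono : StrictMonoOn Φ (Set.Icc 0 m) := by
    apply strictMonoOn_of_deriv_pos (convex_Icc 0 m)
    · exact fun T _ => (hd T).continuousAt.continuousWithinAt
    · intro T hT
      rw [interior_Icc] at hT
      rw [(hd T).deriv]
      apply mul_pos hT.1
      have := hcon T hT.1
      rw [sub_pos, lt_div_iff₀ hm]; linarith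
  have h0 := hmono (Set.left_mem_Icc.2 hm.le) (Set.right_mem_Icc.2 hm.le) hm
  have hΦ0 : Φ 0 = 0 := by
    have : ptail (n + 3) 0 = 0 := by
      rw [ptail_eq, Finset.sum_range_succ']; simp
    simp [Φ, this]
  have hkey : m ^ 2 * ∑ i ∈ Finset.range (n + 1), m ^ i / (Nat.factorial i : ℝ) ≤
      ((n : ℝ) + 1) * (n + 2) * ∑ i ∈ Finset.range (n + 3), m ^ i / (Nat.factorial i : ℝ) := by
    rw [Finset.sum_range_succ' _ (n + 2), Finset.sum_range_succ' _ (n + 1), Finset.mul_sum]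
    have : ∑ i ∈ Finset.range (n + 1), m ^ 2 * (m ^ i / (Nat.factorial i : ℝ)) ≤
      ((n : ℝ) + 1) * (n + 2) * ∑ i ∈ Finset.range (n + 1), m ^ (i + 1 + 1) / (Nat.factorial (i + 1 + 1) : ℝ) := by
      rw [Finset.mul_sum]
      apply Finset.sum_le_sum
      intro i hi
      have hi' : (i : ℝ) ≤ n := by exact_mod_cast Nat.lt_succ_iff.mp (Finset.mem_range.mp hi)
      have h1 : ((Nat.factorial (i + 1 + 1) : ℕ) : ℝ) = (i + 2) * ((i + 1) * (Nat.factorial i)) := by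
        rw [Nat.factorial_succ, Nat.factorial_succ]; push_cast; ring
      have h2 : ((Nat.factorial i : ℕ) : ℝ) ≠ 0 := by positivity
      have h3 : (i : ℝ) + 1 ≠ 0 := by positivity
      have h4 : (i : ℝ) + 2 ≠ 0 := by positivity
      have e : m ^ 2 * (m ^ i / (Nat.factorial i : ℝ)) =
          ((i : ℝ) + 1) * (i + 2) * (m ^ (i + 1 + 1) / (Nat.factorial (i + 1 + 1) : ℝ)) := by
        rw [h1]; field_simp; ring
      rw [e]
      apply mul_le_mul_of_nonneg_right _ (by positivity)
      have : (0 : ℝ) ≤ i := by positivity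
      nlinarith
    have h5 : 0 ≤ ((n : ℝ) + 1) * (n + 2) * (m ^ (0 + 1) / (Nat.factorial (0 + 1) : ℝ) + m ^ 0 / (Nat.factorial 0 : ℝ)) := by
      positivity
    nlinarith
  have hkey2 : m ^ 2 * (1 - ptail (n + 1) m) ≤ ((n : ℝ) + 1) * (n + 2) * (1 - ptail (n + 3) m) := by
    rw [ptail_eq, ptail_eq]
    have := mul_le_mul_of_nonneg_left hkey (Real.exp_pos (-m)).le
    linarith
  rw [hΦ0] at h0
  have e : Φ m = m ^ 2 / 3 - m ^ 2 * ptail (n + 1) m / 2 +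
    ((n : ℝ) + 1) * (n + 2) / 2 * ptail (n + 3) m := by
    simp only [Φ]; congr 2; field_simp
  push_cast at h
  nlinarith

lemma exist_l0 (k : ℕ) (hk : 2 ≤ k) (m : ℝ) (hm : 0 < m)
    (hD : m * sumFrom (k - 1) m = 2 * (k : ℝ) * sumFrom k m) :
    ∃ l : ℝ, 0 < l ∧ l ≤ m * ptail k l := by
  obtain ⟨n, rfl⟩ : ∃ n, k = n + 1 := ⟨k - 1, by omega⟩
  rw [Nat.add_sub_cancel] at hD
  push_cast at hD
  have hlow := fun y hy h1 h2 => m_low n m y hm hy hD h1 h2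
  have ee : Real.exp 1 * Real.exp (-1) = 1 := by rw [← Real.exp_add]; simp
  have he := Real.exp_one_gt_d9
  have hp : 0 < Real.exp (-1) := Real.exp_pos _
  have he1 : Real.exp (-1) < 0.36788 := by nlinarith
  have hpow : ∀ j : ℕ, Real.exp (-(j : ℝ)) ≤ 0.36788 ^ j := by
    intro j
    have : Real.exp (-(j : ℝ)) = Real.exp (-1) ^ j := by rw [← Real.exp_nat_mul]; simp
    rw [this]
    exact pow_le_pow_left₀ hp.le he1.le j
  by_cases h1 : n = 1
  · subst h1
    have := hlow 3.4 (by norm_num) (by norm_num) (by norm_num)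
    refine ⟨2, by norm_num, ?_⟩
    have h2 := hpow 2
    have : (0.59 : ℝ) ≤ ptail (1 + 1) 2 := by
      rw [ptail_eq]; simp [Finset.sum_range_succ, Nat.factorial]
      norm_num at h2 ⊢
      linarith
    nlinarith
  by_cases h1 : n = 2
  · subst h1
    have := hlow 5.4 (by norm_num) (by norm_num) (by norm_num)
    refine ⟨3, by norm_num, ?_⟩
    have h2 := hpow 3
    have : (0.57 : ℝ) ≤ ptail (2 + 1) 3 := by
      rw [ptail_eq]; simp [Finset.sum_range_succ, Nat.factorial]
      norm_num at h2 ⊢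
      linarith
    nlinarith
  by_cases h1 : n = 3
  · subst h1
    have := hlow 7 (by norm_num) (by norm_num) (by norm_num)
    refine ⟨5, by norm_num, ?_⟩
    have h2 := hpow 5
    have : (0.73 : ℝ) ≤ ptail (3 + 1) 5 := by
      rw [ptail_eq]; simp [Finset.sum_range_succ, Nat.factorial]
      norm_num at h2 ⊢
      linarith
    nlinarith
  have hn : 4 ≤ n := by omega
  have hn' : (4 : ℝ) ≤ n := by exact_mod_cast hn
  have := hlow (1.9 * (n + 1)) (by positivity) (by linarith) (by
    have r1 : (9.5 / 6 : ℝ) ≤ 1.9 * (n + 1) / (n + 2) := by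
      rw [div_le_div_iff₀ (by norm_num) (by positivity)]; linarith
    have r2 : (9.5 / 7 : ℝ) ≤ 1.9 * (n + 1) / (n + 3) := by
      rw [div_le_div_iff₀ (by norm_num) (by positivity)]; linarith
    have r3 : (9.5 / 8 : ℝ) ≤ 1.9 * (n + 1) / (n + 4) := by
      rw [div_le_div_iff₀ (by norm_num) (by positivity)]; linarith
    have r4 : (9.5 / 9 : ℝ) ≤ 1.9 * (n + 1) / (n + 5) := by
      rw [div_le_div_iff₀ (by norm_num) (by positivity)]; linarith
    have r5 : (9.5 / 10 : ℝ) ≤ 1.9 * (n + 1) / (n + 6) := by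
      rw [div_le_div_iff₀ (by norm_num) (by positivity)]; linarith
    have : (10 : ℝ) ≤ (1 + 1.9 * (n + 1) / (n + 2) * (1 + 1.9 * (n + 1) / (n + 3) * (1 + 1.9 * (n + 1) / (n + 4) *
      (1 + 1.9 * (n + 1) / (n + 5) * (1 + 1.9 * (n + 1) / (n + 6)))))) := by
      calc (10 : ℝ) ≤ (1 + 9.5 / 6 * (1 + 9.5 / 7 * (1 + 9.5 / 8 *
            (1 + 9.5 / 9 * (1 + 9.5 / 10))))) := by norm_num
        _ ≤ _ := by gcongr
    have h3 : (0 : ℝ) < n + 1 := by positivity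
    nlinarith)
  apply moment (n + 1) m hm (by omega)
  push_cast
  nlinarith

/-- `d` propagates. -/
lemma d_prop (n : ℕ) {x y : ℝ} (hx : 0 < x) (hxy : x ≤ y)
    (h : ptail (n + 1) y ≤ y * (Real.exp (-y) * (y ^ n / (Nat.factorial n)))) :
    ptail (n + 1) x ≤ x * (Real.exp (-x) * (x ^ n / (Nat.factorial n))) := by
  have hy := hx.trans_le hxy
  have hs := sumFrom_scale (n + 1) hx hxy
  rw [ptail_eq'] at h ⊢
  have h' : sumFrom (n + 1) y ≤ y ^ (n + 1) / (Nat.factorial n) := by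
    have : Real.exp (-y) * sumFrom (n + 1) y ≤ Real.exp (-y) * (y ^ (n + 1) / (Nat.factorial n)) := by
      refine h.trans (le_of_eq ?_); ring
    exact le_of_mul_le_mul_left this (Real.exp_pos _)
  have h2 : sumFrom (n + 1) x ≤ x ^ (n + 1) / (Nat.factorial n) := by
    refine hs.trans ((mul_le_mul_of_nonneg_left h' (by positivity)).trans (le_of_eq ?_))
    rw [div_pow]; field_simp
  calc _ ≤ Real.exp (-x) * (x ^ (n + 1) / (Nat.factorial n)) :=
        mul_le_mul_of_nonneg_left h2 (Real.exp_pos _).le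
    _ = _ := by ring

lemma q_deriv (n : ℕ) {x : ℝ} (hx : 0 < x) :
    HasDerivAt (fun l => ptail (n + 1) l / l)
      ((Real.exp (-x) * (x ^ n / (Nat.factorial n)) * x - ptail (n + 1) x * 1) / x ^ 2) x :=
  (ptail_deriv n x).div (hasDerivAt_id x) hx.ne'

lemma q_mono (n : ℕ) {x y : ℝ} (hx : 0 < x) (hxy : x ≤ y)
    (h : ptail (n + 1) y ≤ y * (Real.exp (-y) * (y ^ n / (Nat.factorial n)))) :
    ptail (n + 1) x / x ≤ ptail (n + 1) y / y := by
  have : MonotoneOn (fun l => ptail (n + 1) l / l) (Set.Icc x y) := by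
    apply monotoneOn_of_deriv_nonneg (convex_Icc x y)
    · exact fun T hT => (q_deriv n (hx.trans_le hT.1)).continuousAt.continuousWithinAt
    · intro T hT
      rw [interior_Icc] at hT
      exact (q_deriv n (hx.trans hT.1)).differentiableAt.differentiableWithinAt
    · intro T hT
      rw [interior_Icc] at hT
      have hT0 := hx.trans hT.1
      rw [(q_deriv n hT0).deriv]
      have := d_prop n hT0 hT.2.le h
      apply div_nonneg _ (by positivity)
      linarith
  exact this (Set.left_mem_Icc.2 hxy) (Set.right_mem_Icc.2 hxy) hxy

lemma q_anti (n : ℕ) {x y : ℝ} (hx : 0 < x) (hxy : x < y)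
    (h : x * (Real.exp (-x) * (x ^ n / (Nat.factorial n))) < ptail (n + 1) x) :
    ptail (n + 1) y / y < ptail (n + 1) x / x := by
  have : StrictAntiOn (fun l => ptail (n + 1) l / l) (Set.Icc x y) := by
    apply strictAntiOn_of_deriv_neg (convex_Icc x y)
    · exact fun T hT => (q_deriv n (hx.trans_le hT.1)).continuousAt.continuousWithinAt
    · intro T hT
      rw [interior_Icc] at hT
      have hT0 := hx.trans hT.1
      rw [(q_deriv n hT0).deriv]
      have : T * (Real.exp (-T) * (T ^ n / (Nat.factorial n))) < ptail (n + 1) T := by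
        by_contra hc
        exact absurd (d_prop n hx hT.1.le (not_lt.mp hc)) (not_le.mpr h)
      apply div_neg_of_neg_of_pos _ (by positivity)
      linarith
  exact this (Set.left_mem_Icc.2 hxy.le) (Set.right_mem_Icc.2 hxy.le) hxy

lemma root_above (n : ℕ) {l x : ℝ} (hl : 0 < l) (hx : 0 < x) (h : l < x * ptail (n + 1) l) :
    ∃ mu, l < mu ∧ mu = x * ptail (n + 1) mu := by
  have hle := ptail_le_one (n + 1) hl.le
  have hlx : l ≤ x := by nlinarith
  have hc : ContinuousOn (fun t => x * ptail (n + 1) t - t) (Set.Icc l x) :=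
    ((continuous_const.mul (ptail_contDiff (n + 1)).continuous).sub continuous_id).continuousOn
  have := intermediate_value_Icc' hlx hc
  have h1 := ptail_le_one (n + 1) hx.le
  have h0 : (0 : ℝ) ∈ Set.Icc (x * ptail (n + 1) x - x) (x * ptail (n + 1) l - l) :=
    ⟨by nlinarith, by linarith⟩
  obtain ⟨mu, hmu, hmu2⟩ := this h0
  refine ⟨mu, lt_of_le_of_ne hmu.1 ?_, by simp only at hmu2; linarith⟩
  rintro rfl
  simp only at hmu2
  linarith

lemma lam_deriv (n : ℕ) (m l0 : ℝ) (hm : 0 < m) (hl0 : 0 < l0) (hl : l0 ≤ m * ptail (n + 1) l0)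
    (lam : ℝ → ℝ)
    (hlam : ∀ x, m < x → lam x = x * ptail (n + 1) (lam x) ∧
      ∀ mu, mu = x * ptail (n + 1) mu → mu ≤ lam x) (x : ℝ) (hx : m < x) :
    ∃ a : ℝ, HasDerivAt lam a x ∧
      a * (ptail (n + 1) (lam x) - lam x * (Real.exp (-lam x) * (lam x ^ n / (Nat.factorial n))))
        = ptail (n + 1) (lam x) ^ 2 := by
  have hx0 := hm.trans hx
  have hp0 := ptail_pos (n + 1) hl0
  obtain ⟨mu, hmu, hmu2⟩ := root_above n hl0 hx0 (by nlinarith)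
  obtain ⟨hL, hLmax⟩ := hlam x hx
  have hlL : l0 < lam x := hmu.trans_le (hLmax mu hmu2)
  set L := lam x with hLdef
  have hL0 : 0 < L := hl0.trans hlL
  have hpL := ptail_pos (n + 1) hL0
  have hd : L * (Real.exp (-L) * (L ^ n / (Nat.factorial n))) < ptail (n + 1) L := by
    by_contra hc
    have h := q_mono n hl0 hlL.le (not_lt.mp hc)
    have h1 : 1 / m ≤ ptail (n + 1) l0 / l0 := by
      rw [div_le_div_iff₀ hm hl0]; linarith
    have h2 : ptail (n + 1) L / L = 1 / x := by
      rw [div_eq_div_iff hL0.ne' hx0.ne']; linarith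
    have h3 : 1 / x < 1 / m := one_div_lt_one_div_of_lt hm hx
    linarith
  set D := ptail (n + 1) L - L * (Real.exp (-L) * (L ^ n / (Nat.factorial n))) with hDdef
  have hDpos : 0 < D := sub_pos.2 hd
  let h : ℝ → ℝ := fun l => l / ptail (n + 1) l
  have hder : HasDerivAt h (D / ptail (n + 1) L ^ 2) L := by
    have := (hasDerivAt_id L).div (ptail_deriv n L) hpL.ne'
    refine this.congr_deriv ?_
    simp [hDdef]
  have hcd : ContDiffAt ℝ 1 h L :=
    contDiffAt_id.div (ptail_contDiff (n + 1)).contDiffAt hpL.ne'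
  have hstrict : HasStrictDerivAt h (D / ptail (n + 1) L ^ 2) L :=
    hcd.hasStrictDerivAt' hder (by norm_num)
  have hne : D / ptail (n + 1) L ^ 2 ≠ 0 := by positivity
  have hhL : h L = x := by
    simp only [h]; rw [div_eq_iff hpL.ne']; exact hL
  set g := hstrict.localInverse h _ L hne with hg
  have hgd : HasStrictDerivAt g (D / ptail (n + 1) L ^ 2)⁻¹ (h L) := hstrict.to_localInverse hne
  have hgr : ∀ᶠ y in nhds (h L), h (g y) = y := hstrict.eventually_right_inverse hne
  have hgL : g (h L) = L := by
    have := hstrict.eventually_left_inverse hne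
    exact this.self_of_nhds
  rw [hhL] at hgd hgr hgL
  have hgc : Tendsto g (nhds x) (nhds L) := by
    have := hgd.hasDerivAt.continuousAt.tendsto
    rwa [hgL] at this
  have hopen : ∀ᶠ l in nhds L, l * (Real.exp (-l) * (l ^ n / (Nat.factorial n))) < ptail (n + 1) l := by
    apply ContinuousAt.eventually_lt _ _ hd
    · fun_prop
    · exact (ptail_contDiff (n + 1)).continuous.continuousAt
  have hev : lam =ᶠ[nhds x] g := by
    filter_upwards [hgr, hgc.eventually hopen, hgc.eventually (lt_mem_nhds hL0), lt_mem_nhds hx]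
      with y hy1 hy2 hy3 hy4
    have hpy := ptail_pos (n + 1) hy3
    have hroot : g y = y * ptail (n + 1) (g y) := by
      simp only [h] at hy1
      rwa [div_eq_iff hpy.ne'] at hy1
    obtain ⟨hA, hB⟩ := hlam y hy4
    have hle := hB _ hroot
    by_contra hne'
    have hlt : g y < lam y := lt_of_le_of_ne hle (Ne.symm hne')
    have hq := q_anti n hy3 hlt hy2
    have hly := hy3.trans hlt
    have hy0 := hm.trans hy4
    have e1 : ptail (n + 1) (lam y) / lam y = 1 / y := by
      rw [div_eq_div_iff hly.ne' hy0.ne']; linarith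
    have e2 : ptail (n + 1) (g y) / g y = 1 / y := by
      rw [div_eq_div_iff hy3.ne' hy0.ne']; linarith
    linarith
  refine ⟨(D / ptail (n + 1) L ^ 2)⁻¹, hgd.hasDerivAt.congr_of_eventuallyEq hev, ?_⟩
  field_simp

end S15

theorem stmt15 (k : ℕ) (hk : 2 ≤ k) (c' : ℝ) (hc' : IsCkPrime k c')
    (lam : ℝ → ℝ) (hlam : ∀ x : ℝ, 2 * c' < x → IsLambda (k + 1) x (lam x)) :
    (∀ c : ℝ, c' < c →
      HasDerivAt (fun t : ℝ =>
          t - lam (2 * t) * ptail k (lam (2 * t)) / 2 + k * ptail (k + 1) (lam (2 * t)))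
        (1 - (lam (2 * c) / (2 * c)) ^ 2) c) ∧
    (∀ c : ℝ, 2 * c' < c → IsBetaVal k c (lam c / c)) := by
  obtain ⟨hc0, hceq⟩ := hc'
  have hm : 0 < 2 * c' := by linarith
  simp only [IsLambda, Nat.add_sub_cancel] at hlam
  constructor
  · intro c hc
    obtain ⟨l0, hl0, hl⟩ := S15.exist_l0 k hk (2 * c') hm (by linarith)
    obtain ⟨n, rfl⟩ : ∃ n, k = n + 1 := ⟨k - 1, by omega⟩
    have hx : 2 * c' < 2 * c := by linarith
    obtain ⟨a, ha, haeq⟩ := S15.lam_deriv n (2 * c') l0 hm hl0 hl lam hlam (2 * c) hx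
    have hL := (hlam (2 * c) hx).1
    have hlin : HasDerivAt (fun t : ℝ => 2 * t) 2 c := by
      simpa using (hasDerivAt_id c).const_mul 2
    have hcomp : HasDerivAt (fun t : ℝ => lam (2 * t)) (a * 2) c := HasDerivAt.comp c ha hlin
    have hp1 : HasDerivAt (fun t : ℝ => ptail (n + 1) (lam (2 * t)))
        (Real.exp (-lam (2 * c)) * (lam (2 * c) ^ n / (Nat.factorial n)) * (a * 2)) c :=
      HasDerivAt.comp (h₂ := ptail (n + 1)) c (S15.ptail_deriv n (lam (2 * c))) hcomp
    have hp2 : HasDerivAt (fun t : ℝ => ptail (n + 1 + 1) (lam (2 * t)))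
        (Real.exp (-lam (2 * c)) * (lam (2 * c) ^ (n + 1) / (Nat.factorial (n + 1))) * (a * 2)) c :=
      HasDerivAt.comp (h₂ := ptail (n + 1 + 1)) c (S15.ptail_deriv (n + 1) (lam (2 * c))) hcomp
    have h := ((hasDerivAt_id c).sub ((hcomp.mul hp1).div_const 2)).add
      (hp2.const_mul (((n + 1 : ℕ) : ℝ)))
    refine h.congr_deriv ?_
    have hc2 : 2 * c ≠ 0 := by
      have : 0 < c := hc0.trans hc
      positivity
    have hb : lam (2 * c) / (2 * c) = ptail (n + 1) (lam (2 * c)) := by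
      rw [div_eq_iff hc2]; linarith
    rw [hb, ← haeq]
    have h1 : ((Nat.factorial (n + 1) : ℕ) : ℝ) = (n + 1) * (Nat.factorial n) := by
      rw [Nat.factorial_succ]; push_cast; ring
    have h2 : ((Nat.factorial n : ℕ) : ℝ) ≠ 0 := by positivity
    have h3 : (n : ℝ) + 1 ≠ 0 := by positivity
    rw [h1]; push_cast; field_simp; ring
  · intro c hc
    have hc0' : 0 < c := hm.trans hc
    obtain ⟨hA, hB⟩ := hlam c hc
    constructor
    · rw [div_mul_cancel₀ _ hc0'.ne', div_eq_iff hc0'.ne']; linarith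
    · intro b' hb'
      rw [le_div_iff₀ hc0']
      apply hB
      rw [← hb']; ring
end
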